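/- Let A ∈ M_n(𝕋) be tropically regular with pseudo inverse A^∇ = Adj(A) ⊙ |A|^{-1}. Then: (1) Adj(A) is tropically regular, and A^∇ is tropically regular with |A| ⊙ |A^∇| = 0 (i.e. |A^∇| = |A|^{-1}); (2) if moreover A = A^∇, then |A| = 0. -/

import Mathlib

/-- The extended tropical semiring `𝕋 = ℝ ∪ {−∞} ∪ ℝ^ν`:
`neginf` is `−∞`, `real a` is the real (tangible) element `a`,
and `ghost a` is the ghost element `a^ν`. -/
inductive T : Type where
  | neginf : T
  | real : ℝ → T
  | ghost : ℝ → T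

namespace T

/-- Tropical addition `⊕` on `𝕋`. -/
noncomputable def add : T → T → T
  | neginf, x => x
  | real a, neginf => real a
  | ghost a, neginf => ghost a
  | real a, real b => if a < b then real b else if b < a then real a else ghost a
  | real a, ghost b => if a ≤ b then ghost b else real a
  | ghost a, real b => if b ≤ a then ghost a else real b
  | ghost a, ghost b => if a < b then ghost b else ghost a

/-- Tropical multiplication `⊙` on `𝕋`. -/
noncomputable def mul : T → T → T
  | neginf, _ => neginf
  | real _, neginf => neginf
  | ghost _, neginf => neginf
  | real a, real b => real (a + b)
  | real a, ghost b => ghost (a + b)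
  | ghost a, real b => ghost (a + b)
  | ghost a, ghost b => ghost (a + b)

/-- The strict order `≺` on `𝕋`. -/
def lt : T → T → Prop
  | neginf, neginf => False
  | neginf, real _ => True
  | neginf, ghost _ => True
  | real _, neginf => False
  | ghost _, neginf => False
  | real a, real b => a < b
  | real a, ghost b => a ≤ b
  | ghost a, real b => a < b
  | ghost a, ghost b => a < b

/-- The order `⪯` on `𝕋`: `x ⪯ y` iff `x = y` or `x ≺ y`. -/
def le (x y : T) : Prop := x = y ∨ lt x y

/-- Membership in `ℝ̄^ν = ℝ^ν ∪ {−∞}` (the ghost elements together with `−∞`). -/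
def isGhost : T → Prop
  | neginf => True
  | real _ => False
  | ghost _ => True

/-- Membership in `ℝ` (the real, tangible elements). -/
def isReal : T → Prop
  | neginf => False
  | real _ => True
  | ghost _ => False

/-- The ghost map `ν : 𝕋 → ℝ̄^ν`. -/
def nu : T → T
  | neginf => neginf
  | real a => ghost a
  | ghost a => ghost a

/-- The projection `π : 𝕋 → ℝ ∪ {−∞}` onto the max-plus semiring `(ℝ ∪ {−∞}, max, +)`,
realized as `WithBot ℝ`. -/
def pi : T → WithBot ℝ
  | neginf => ⊥
  | real a => (a : WithBot ℝ)
  | ghost a => (a : WithBot ℝ)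

/-- The embedding `θ : (ℝ ∪ {−∞}, max, +) → 𝕋`, `a ↦ a^ν`, `−∞ ↦ −∞`. -/
def theta : WithBot ℝ → T :=
  fun x => WithBot.recBotCoe neginf (fun a => ghost a) x

/-- `pow x n` is the `n`-fold tropical product `x ⊙ x ⊙ ⋯ ⊙ x` (with `pow x 0 = 0`, the one). -/
noncomputable def pow (x : T) : ℕ → T
  | 0 => real 0
  | n + 1 => mul x (pow x n)

instance : Std.Commutative add := ⟨by
  intro x y
  cases x <;> cases y <;> simp only [add] <;> split_ifs <;>
    first | rfl | (exfalso; linarith) | (congr 1; linarith)⟩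

instance : Std.Associative add := ⟨by
  intro x y z
  cases x <;> cases y <;> cases z <;>
    simp only [add] <;>
    repeat' (first | split_ifs | simp only [add]) 
  all_goals first | rfl | (exfalso; linarith) | (congr 1; linarith)⟩

instance : Std.Commutative mul := ⟨by
  intro x y
  cases x <;> cases y <;> simp only [mul] <;> congr 1 <;> ring⟩

instance : Std.Associative mul := ⟨by
  intro x y z
  cases x <;> cases y <;> cases z <;> simp only [mul] <;> congr 1 <;> ring⟩

/-- Finite tropical sum `⊕` over a finite index set. -/
noncomputable def sumT {ι : Type*} (s : Finset ι) (f : ι → T) : T := s.fold add neginf f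

/-- Finite tropical product `⊙` over a finite index set. -/
noncomputable def prodT {ι : Type*} (s : Finset ι) (f : ι → T) : T := s.fold mul (real 0) f

/-- Tropical matrix multiplication over `𝕋`. -/
noncomputable def matMul {n : ℕ} (A B : Matrix (Fin n) (Fin n) T) : Matrix (Fin n) (Fin n) T :=
  fun i j => sumT Finset.univ fun k => mul (A i k) (B k j)

/-- The tropical determinant (permanent) `|A| = ⊕_{σ ∈ S_n} a_{1σ(1)} ⊙ ⋯ ⊙ a_{nσ(n)}`. -/
noncomputable def det {n : ℕ} (A : Matrix (Fin n) (Fin n) T) : T :=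
  sumT Finset.univ fun σ : Equiv.Perm (Fin n) => prodT Finset.univ fun i => A i (σ i)

/-- `A` is tropically regular if `|A| ∈ ℝ`. -/
def regular {n : ℕ} (A : Matrix (Fin n) (Fin n) T) : Prop := isReal (det A)

/-- `A` is tropically singular if `|A| ∈ ℝ̄^ν`. -/
def singular {n : ℕ} (A : Matrix (Fin n) (Fin n) T) : Prop := isGhost (det A)

/-- The minor `A_{ij}`: delete row `i` and column `j`. -/
noncomputable def minor {n : ℕ} (A : Matrix (Fin (n+1)) (Fin (n+1)) T) (i j : Fin (n+1)) :
    Matrix (Fin n) (Fin n) T :=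
  A.submatrix i.succAbove j.succAbove

/-- The adjoint matrix `Adj(A)`, the transpose of the matrix of minors' determinants. -/
noncomputable def adj {n : ℕ} (A : Matrix (Fin (n+1)) (Fin (n+1)) T) :
    Matrix (Fin (n+1)) (Fin (n+1)) T :=
  fun i j => det (minor A j i)

/-- The `⊙`-inverse `x^{-1}` (only meaningful away from `−∞`): `a ↦ −a`, `a^ν ↦ (−a)^ν`. -/
def dinv : T → T
  | neginf => neginf
  | real a => real (-a)
  | ghost a => ghost (-a)

/-- The pseudo inverse `A^∇ = Adj(A) ⊙ |A|^{-1}`. -/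
noncomputable def pinv {n : ℕ} (A : Matrix (Fin (n+1)) (Fin (n+1)) T) :
    Matrix (Fin (n+1)) (Fin (n+1)) T :=
  fun i j => mul (adj A i j) (dinv (det A))

/-- A pseudo unit matrix: tropically regular, `0` on the diagonal,
and ghosts (or `−∞`) off the diagonal. -/
def pseudoUnit {n : ℕ} (E : Matrix (Fin n) (Fin n) T) : Prop :=
  regular E ∧ (∀ i, E i i = real 0) ∧ ∀ i j, i ≠ j → isGhost (E i j)

/-- `A` is pseudo invertible if `A ⊙ B` and `B ⊙ A` are pseudo units for some `B`. -/
def pseudoInvertible {n : ℕ} (A : Matrix (Fin n) (Fin n) T) : Prop :=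
  ∃ B, pseudoUnit (matMul A B) ∧ pseudoUnit (matMul B A)

/-- The ray/point `P_x ⊆ ℝ ∪ {−∞}` assigned to `x ∈ 𝕋`:
`P_{−∞} = {−∞}`, `P_a = {a}`, `P_{a^ν} = [−∞, a]`. -/
def P : T → Set (WithBot ℝ)
  | neginf => {⊥}
  | real a => {(a : WithBot ℝ)}
  | ghost a => {t | t ≤ (a : WithBot ℝ)}

end T

open Finset in
/-- A nonnegative integer matrix with constant positive row and column sums dominates a
permutation matrix. -/
theorem exists_perm_apply_ne_zero {ι : Type*} [Fintype ι] {d : ℕ} (hd : 0 < d)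
    {N : ι → ι → ℕ} (hrow : ∀ i, ∑ j, N i j = d) (hcol : ∀ j, ∑ i, N i j = d) :
    ∃ p : Equiv.Perm ι, ∀ i, N i (p i) ≠ 0 := by
  classical
  let f (i : ι) : Finset ι := {j | N i j ≠ 0}
  have hf (s : Finset ι) : #s ≤ #(s.biUnion f) := by
    have h₁ : ∑ i ∈ s, ∑ j ∈ f i, N i j = #s * d := by
      simp [f, sum_subset (filter_subset _ _), hrow]
    have h₂ : ∑ i, ∑ j ∈ s.biUnion f, N i j = #(s.biUnion f) * d := by
      simp [sum_comm (t := s.biUnion f), hcol]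
    refine le_of_mul_le_mul_right ?_ hd
    rw [← h₁, ← h₂]
    calc ∑ i ∈ s, ∑ j ∈ f i, N i j ≤ ∑ i ∈ s, ∑ j ∈ s.biUnion f, N i j :=
          sum_le_sum fun i hi => sum_le_sum_of_subset (subset_biUnion_of_mem f hi)
      _ ≤ _ := sum_le_sum_of_subset (subset_univ s)
  obtain ⟨g, hg, hg'⟩ := (all_card_le_biUnion_card_iff_exists_injective f).1 hf
  exact ⟨Equiv.ofBijective g (Finite.injective_iff_bijective.1 hg), fun i => by
    simpa [f] using hg' i⟩

/-- If the permutation `τ` has weight `w` and every other permutation has smaller weight, then a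
`d`-regular bipartite multigraph `N` has weight at most `d * w`, and less than that unless it is
supported on `τ`. -/
theorem sum_nsmul_le_of_forall_perm_lt {ι : Type*} [Fintype ι] {c : ι → ι → WithBot ℝ}
    {τ : Equiv.Perm ι} {w : ℝ} (hτ : ∑ i, c i (τ i) = w)
    (hlt : ∀ σ : Equiv.Perm ι, σ ≠ τ → ∑ i, c i (σ i) < w) (d : ℕ) :
    ∀ N : ι → ι → ℕ, (∀ i, ∑ j, N i j = d) → (∀ j, ∑ i, N i j = d) →
      ∑ i, ∑ j, N i j • c i j ≤ ((d * w : ℝ) : WithBot ℝ) ∧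
      ((∃ i j, N i j ≠ 0 ∧ j ≠ τ i) →
        ∑ i, ∑ j, N i j • c i j < ((d * w : ℝ) : WithBot ℝ)) := by
  classical
  induction d with
  | zero =>
    intro N hrow _
    have hN : ∀ i j, N i j = 0 := fun i j => by
      have := hrow i
      rw [Finset.sum_eq_zero_iff] at this
      exact this j (Finset.mem_univ j)
    simp [hN]
  | succ d ih =>
    intro N hrow hcol
    obtain ⟨p, hp⟩ := exists_perm_apply_ne_zero d.succ_pos hrow hcol
    obtain ⟨N', hN'⟩ : ∃ N' : ι → ι → ℕ, ∀ i j, N i j = (if p i = j then 1 else 0) + N' i j := by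
      refine ⟨fun i j => N i j - if p i = j then 1 else 0, fun i j => ?_⟩
      by_cases h : p i = j
      · subst h
        have := hp i
        simp only [if_true]
        omega
      · simp [h]
    have hsum : ∑ i, ∑ j, N i j • c i j = ∑ i, c i (p i) + ∑ i, ∑ j, N' i j • c i j := by
      simp [hN', add_smul, Finset.sum_add_distrib, ite_smul]
    have hcast : (((d + 1 : ℕ) * w : ℝ) : WithBot ℝ) = w + ((d * w : ℝ) : WithBot ℝ) := by
      rw [← WithBot.coe_add]
      congr 1
      push_cast
      ring
    obtain ⟨hle, hlt'⟩ := ih N'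
      (fun i => by
        have := hrow i
        simp only [hN', Finset.sum_add_distrib, Finset.sum_ite_eq, Finset.mem_univ, if_true] at this
        omega)
      (fun j => by
        have := hcol j
        simp only [hN', Finset.sum_add_distrib, ← Equiv.eq_symm_apply, Finset.sum_ite_eq',
          Finset.mem_univ, if_true] at this
        omega)
    rw [hsum, hcast]
    by_cases hpτ : p = τ
    · subst hpτ
      rw [hτ]
      refine ⟨by gcongr, fun ⟨i, j, hij, hj⟩ => ?_⟩
      refine WithBot.add_lt_add_left WithBot.coe_ne_bot (hlt' ⟨i, j, ?_, hj⟩)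
      rwa [hN', if_neg (Ne.symm hj), zero_add] at hij
    · have := (add_le_add_right hle (∑ i, c i (p i))).trans_lt
        (WithBot.add_lt_add_right WithBot.coe_ne_bot (hlt p hpτ))
      exact ⟨this.le, fun _ => this⟩

namespace T

theorem eq_real_iff {x : T} {w : ℝ} : x = real w ↔ isReal x ∧ pi x = w := by
  cases x <;> simp [isReal, pi]

theorem pi_add (x y : T) : pi (add x y) = max (pi x) (pi y) := by
  cases x <;> cases y <;> simp only [add] <;> (try split_ifs) <;>
    simp [pi] <;> linarith

theorem pi_mul (x y : T) : pi (mul x y) = pi x + pi y := by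
  cases x <;> cases y <;> simp [pi, mul]

theorem isReal_mul {x y : T} : isReal (mul x y) ↔ isReal x ∧ isReal y := by
  cases x <;> cases y <;> simp [isReal, mul]

theorem add_eq_real_iff {x y : T} {w : ℝ} :
    add x y = real w ↔ x = real w ∧ pi y < w ∨ y = real w ∧ pi x < w := by
  cases x <;> cases y <;> simp only [add] <;> (try split_ifs) <;> simp [pi] <;> grind

theorem pi_prodT {ι : Type*} (s : Finset ι) (f : ι → T) : pi (prodT s f) = ∑ i ∈ s, pi (f i) := by
  classical
  induction s using Finset.induction_on with
  | empty => simp [prodT, pi]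
  | insert a s ha ih =>
    rw [Finset.sum_insert ha, ← ih, ← pi_mul, prodT, Finset.fold_insert ha, prodT]

theorem isReal_prodT {ι : Type*} {s : Finset ι} {f : ι → T} :
    isReal (prodT s f) ↔ ∀ i ∈ s, isReal (f i) := by
  classical
  induction s using Finset.induction_on with
  | empty => simp [prodT, isReal]
  | insert a s ha ih =>
    rw [Finset.forall_mem_insert, ← ih, ← isReal_mul, prodT, Finset.fold_insert ha, prodT]

theorem pi_sumT {ι : Type*} (s : Finset ι) (f : ι → T) :
    pi (sumT s f) = s.sup fun i => pi (f i) := by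
  classical
  induction s using Finset.induction_on with
  | empty => simp [sumT, pi]
  | insert a s ha ih =>
    rw [Finset.sup_insert, ← ih, sumT, Finset.fold_insert ha, pi_add, sumT]

theorem sumT_eq_real_iff {ι : Type*} {s : Finset ι} {f : ι → T} {w : ℝ} :
    sumT s f = real w ↔ ∃ x ∈ s, f x = real w ∧ ∀ y ∈ s, y ≠ x → pi (f y) < w := by
  classical
  induction s using Finset.induction_on with
  | empty => simp [sumT]
  | insert a s ha ih =>
    have hlt : pi (sumT s f) < w ↔ ∀ y ∈ s, pi (f y) < w := by
      rw [pi_sumT, Finset.sup_lt_iff (WithBot.bot_lt_coe w)]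
    rw [sumT, Finset.fold_insert ha, add_eq_real_iff, ← sumT, ih, hlt]
    simp only [Finset.mem_insert]
    constructor
    · rintro (⟨h, h'⟩ | ⟨⟨x, hx, h, h'⟩, h''⟩)
      · exact ⟨a, Or.inl rfl, h, by grind⟩
      · exact ⟨x, Or.inr hx, h, by grind⟩
    · rintro ⟨x, rfl | hx, h, h'⟩
      · exact Or.inl ⟨h, by grind⟩
      · exact Or.inr ⟨⟨x, hx, h, by grind⟩, by grind⟩

theorem det_eq_real_iff {n : ℕ} {A : Matrix (Fin n) (Fin n) T} {w : ℝ} :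
    det A = real w ↔ ∃ τ : Equiv.Perm (Fin n), (∀ i, isReal (A i (τ i))) ∧
      ∑ i, pi (A i (τ i)) = w ∧ ∀ σ : Equiv.Perm (Fin n), σ ≠ τ → ∑ i, pi (A i (σ i)) < w := by
  rw [det, sumT_eq_real_iff]
  simp [eq_real_iff, isReal_prodT, pi_prodT, and_assoc]

theorem exists_pi_det_eq {n : ℕ} (A : Matrix (Fin n) (Fin n) T) :
    ∃ σ : Equiv.Perm (Fin n), pi (det A) = ∑ i, pi (A i (σ i)) := by
  obtain ⟨σ, -, hσ⟩ := Finset.exists_mem_eq_sup Finset.univ Finset.univ_nonempty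
    fun σ : Equiv.Perm (Fin n) => pi (prodT Finset.univ fun i => A i (σ i))
  exact ⟨σ, by rw [det, pi_sumT, hσ, pi_prodT]⟩

theorem det_mul_real {n : ℕ} {B : Matrix (Fin n) (Fin n) T} {v : ℝ} (hB : det B = real v)
    (x : ℝ) : det (fun i j => mul (B i j) (real x)) = real (v + n * x) := by
  obtain ⟨τ, hreal, hτ, hlt⟩ := det_eq_real_iff.1 hB
  have hsum (σ : Equiv.Perm (Fin n)) : ∑ i, pi (mul (B i (σ i)) (real x)) =
      ∑ i, pi (B i (σ i)) + ((n * x : ℝ) : WithBot ℝ) := by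
    simp only [pi_mul, Finset.sum_add_distrib]
    congr 1
    change ∑ _i : Fin n, (x : WithBot ℝ) = _
    rw [← WithBot.coe_sum]
    simp
  refine det_eq_real_iff.2 ⟨τ, fun i => isReal_mul.2 ⟨hreal i, trivial⟩, ?_, fun σ hσ => ?_⟩
  · rw [hsum, hτ, WithBot.coe_add]
  · rw [hsum, WithBot.coe_add]
    exact WithBot.add_lt_add_right WithBot.coe_ne_bot (hlt σ hσ)

/-- A permutation of `Fin n` extends to one of `Fin (n + 1)` sending `r` to `i`. -/
theorem exists_perm_succAbove {n : ℕ} (r i : Fin (n + 1)) (e : Equiv.Perm (Fin n)) :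
    ∃ σ : Equiv.Perm (Fin (n + 1)), σ r = i ∧ ∀ k, σ (r.succAbove k) = i.succAbove (e k) :=
  ⟨(finSuccEquiv' r).trans ((Equiv.optionCongr e).trans (finSuccEquiv' i).symm), by simp,
    by simp⟩

/-- A permutation of `Fin (n + 1)` induces one of `Fin n` by deleting `r` and its image. -/
theorem exists_perm_succAbove_eq {n : ℕ} (r : Fin (n + 1)) (σ : Equiv.Perm (Fin (n + 1))) :
    ∃ e : Equiv.Perm (Fin n), ∀ k, σ (r.succAbove k) = (σ r).succAbove (e k) := by
  have h (k : Fin n) : ∃ l, (σ r).succAbove l = σ (r.succAbove k) :=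
    Fin.exists_succAbove_eq (σ.injective.ne (r.succAbove_ne k))
  choose e he using h
  have he_inj : Function.Injective e := fun k l hkl =>
    r.succAbove_right_injective (σ.injective (by rw [← he, ← he, hkl]))
  exact ⟨Equiv.ofBijective e (Finite.injective_iff_bijective.1 he_inj), fun k => (he k).symm⟩

/-- Deleting an entry on the optimal permutation leaves a regular minor. -/
theorem exists_det_minor_eq_real {n : ℕ} {A : Matrix (Fin (n + 1)) (Fin (n + 1)) T}
    {τ : Equiv.Perm (Fin (n + 1))} {w : ℝ} (hreal : ∀ i, isReal (A i (τ i)))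
    (hτ : ∑ i, pi (A i (τ i)) = w)
    (hlt : ∀ σ : Equiv.Perm (Fin (n + 1)), σ ≠ τ → ∑ i, pi (A i (σ i)) < w)
    (r : Fin (n + 1)) :
    ∃ v : ℝ, det (minor A r (τ r)) = real v ∧ pi (A r (τ r)) + v = w := by
  obtain ⟨e, he⟩ := exists_perm_succAbove_eq r τ
  have hreal' (k : Fin n) : isReal (A (r.succAbove k) ((τ r).succAbove (e k))) :=
    he k ▸ hreal (r.succAbove k)
  rw [Fin.sum_univ_succAbove _ r] at hτ
  simp only [he] at hτ
  obtain ⟨v, hv⟩ : ∃ v : ℝ,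
      ∑ k, pi (A (r.succAbove k) ((τ r).succAbove (e k))) = (v : WithBot ℝ) := by
    refine (WithBot.ne_bot_iff_exists.1 fun h => ?_).imp fun _ => Eq.symm
    simp [h] at hτ
  rw [hv] at hτ
  refine ⟨v, det_eq_real_iff.2 ⟨e, hreal', hv, fun f hf => ?_⟩, hτ⟩
  obtain ⟨σ, hσr, hσ⟩ := exists_perm_succAbove r (τ r) f
  have hne : σ ≠ τ := by
    rintro rfl
    refine hf (Equiv.ext fun k => (σ r).succAbove_right_injective ?_)
    rw [← he, hσ]
  have hσlt := hlt σ hne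
  rw [Fin.sum_univ_succAbove _ r, ← hτ, hσr] at hσlt
  simp only [hσ] at hσlt
  exact lt_of_add_lt_add_left hσlt

/-- Every permutation other than the inverse of the optimal one for `A` has weight less than
`n * |A|` in `Adj(A)`. -/
theorem sum_pi_adj_lt {n : ℕ} {A : Matrix (Fin (n + 1)) (Fin (n + 1)) T}
    {τ : Equiv.Perm (Fin (n + 1))} {w : ℝ} (hτ : ∑ i, pi (A i (τ i)) = w)
    (hlt : ∀ σ : Equiv.Perm (Fin (n + 1)), σ ≠ τ → ∑ i, pi (A i (σ i)) < w)
    {ρ : Equiv.Perm (Fin (n + 1))} (hρ : ρ ≠ τ⁻¹) :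
    ∑ i, pi (adj A i (ρ i)) < ((n * w : ℝ) : WithBot ℝ) := by
  choose e he using fun i => exists_pi_det_eq (minor A (ρ i) i)
  let N (a b : Fin (n + 1)) : ℕ :=
    ∑ i, ∑ k, if (ρ i).succAbove k = a ∧ i.succAbove (e i k) = b then 1 else 0
  have hcount (a i : Fin (n + 1)) :
      (∑ k : Fin n, if i.succAbove k = a then 1 else 0) = if i = a then 0 else 1 := by
    have h := Fin.sum_univ_succAbove (fun j => if j = a then 1 else 0) i
    rw [Finset.sum_ite_eq' Finset.univ a fun _ => 1, if_pos (Finset.mem_univ a)] at h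
    split_ifs at h ⊢ <;> omega
  have hcount' (a : Fin (n + 1)) : (∑ i : Fin (n + 1), if i = a then 0 else 1) = n := by
    rw [Fin.sum_univ_succAbove _ a]
    simp
  have hrow (a : Fin (n + 1)) : ∑ b, N a b = n := by
    calc ∑ b, N a b = ∑ i, ∑ k, if (ρ i).succAbove k = a then 1 else 0 := by
          simp only [N]
          rw [Finset.sum_comm]
          refine Finset.sum_congr rfl fun i _ => ?_
          rw [Finset.sum_comm]
          simp [ite_and]
      _ = ∑ i, if ρ i = a then 0 else 1 := by simp only [hcount]
      _ = n := (Equiv.sum_comp ρ fun j => if j = a then 0 else 1).trans (hcount' a)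
  have hcol (b : Fin (n + 1)) : ∑ a, N a b = n := by
    calc ∑ a, N a b = ∑ i : Fin (n + 1), ∑ k, if i.succAbove (e i k) = b then 1 else 0 := by
          simp only [N]
          rw [Finset.sum_comm]
          refine Finset.sum_congr rfl fun i _ => ?_
          rw [Finset.sum_comm]
          simp [ite_and]
      _ = ∑ i, if i = b then 0 else 1 := by
          refine Finset.sum_congr rfl fun i _ => ?_
          rw [← hcount b i]
          exact Equiv.sum_comp (e i) fun l : Fin n => if i.succAbove l = b then 1 else 0
      _ = n := hcount' b
  have hsum : ∑ i, pi (adj A i (ρ i)) = ∑ a, ∑ b, N a b • pi (A a b) := by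
    have hcell (a b : Fin (n + 1)) : N a b • pi (A a b) = ∑ i, ∑ k,
        if (ρ i).succAbove k = a then
          if i.succAbove (e i k) = b then pi (A a b) else 0 else 0 := by
      simp only [N, Finset.sum_smul, ite_smul, one_smul, zero_smul, ite_and]
    simp only [hcell]
    calc ∑ i, pi (adj A i (ρ i))
        = ∑ i, ∑ k, pi (A ((ρ i).succAbove k) (i.succAbove (e i k))) :=
          Finset.sum_congr rfl fun i _ => he i
      _ = ∑ i, ∑ k, ∑ a, ∑ b, if (ρ i).succAbove k = a then
          if i.succAbove (e i k) = b then pi (A a b) else 0 else 0 := by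
          refine Finset.sum_congr rfl fun i _ => Finset.sum_congr rfl fun k _ => ?_
          rw [Finset.sum_comm]
          simp
      _ = ∑ i, ∑ a, ∑ b, ∑ k, if (ρ i).succAbove k = a then
          if i.succAbove (e i k) = b then pi (A a b) else 0 else 0 := by
          refine Finset.sum_congr rfl fun i _ => ?_
          rw [Finset.sum_comm]
          exact Finset.sum_congr rfl fun a _ => Finset.sum_comm
      _ = _ := by
          rw [Finset.sum_comm]
          exact Finset.sum_congr rfl fun a _ => Finset.sum_comm
  rw [hsum]
  refine (sum_nsmul_le_of_forall_perm_lt hτ hlt n N hrow hcol).2 ?_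
  by_contra! hN
  refine hρ (Equiv.ext fun i => ?_)
  rw [Equiv.Perm.eq_inv_iff_eq]
  by_contra hi
  obtain ⟨k, hk⟩ := Fin.exists_succAbove_eq
    (x := τ⁻¹ i) (y := ρ i) (fun h => hi (by rw [← h]; simp))
  have hNk : N (τ⁻¹ i) (i.succAbove (e i k)) ≠ 0 := by
    intro h
    simp only [N, Finset.sum_eq_zero_iff, Finset.mem_univ, true_imp_iff] at h
    simpa [hk] using h i k
  exact i.succAbove_ne (e i k) ((hN _ _ hNk).trans (τ.apply_symm_apply i))

/-- The adjoint of a regular matrix of order `n + 1` has determinant `|A|^n`. -/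
theorem det_adj {n : ℕ} {A : Matrix (Fin (n + 1)) (Fin (n + 1)) T} {w : ℝ}
    (hA : det A = real w) : det (adj A) = real (n * w) := by
  obtain ⟨τ, hreal, hτ, hlt⟩ := det_eq_real_iff.1 hA
  choose v hv hvw using exists_det_minor_eq_real hreal hτ hlt
  have hadj (r : Fin (n + 1)) : adj A (τ r) r = real (v r) := hv r
  refine det_eq_real_iff.2 ⟨τ⁻¹, fun i => ?_, ?_, fun ρ hρ => sum_pi_adj_lt hτ hlt hρ⟩
  · obtain ⟨r, rfl⟩ := τ.surjective i
    simp [hadj, isReal]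
  · rw [← Equiv.sum_comp τ]
    have hentry (r : Fin (n + 1)) : pi (adj A (τ r) (τ⁻¹ (τ r))) = v r := by
      rw [show τ⁻¹ (τ r) = r from τ.symm_apply_apply r, hadj, pi]
    simp only [hentry]
    have h : (w : WithBot ℝ) + ∑ r, (v r : WithBot ℝ) = w + ((n * w : ℝ) : WithBot ℝ) := by
      rw [← hτ, ← Finset.sum_add_distrib, Finset.sum_congr rfl fun r _ => hvw r, hτ,
        ← WithBot.coe_sum, ← WithBot.coe_add]
      congr 1
      simp
      ring
    rw [← WithBot.coe_sum] at h ⊢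
    norm_cast at h ⊢
    linarith

theorem det_pinv {n : ℕ} {A : Matrix (Fin (n + 1)) (Fin (n + 1)) T} {w : ℝ}
    (hA : det A = real w) : det (pinv A) = real (-w) := by
  have h := det_mul_real (det_adj hA) (-w)
  unfold pinv
  rw [hA, dinv, h]
  congr 1
  push_cast
  ring

end T

/-- for tropically regular `A`: (1) `Adj(A)` is regular, `A^∇` is regular,
`|A| ⊙ |A^∇| = 0` (i.e. `|A^∇| = |A|^{-1}`); (2) if moreover `A = A^∇` then `|A| = 0`. -/
theorem adj_pinv_regular_det {n : ℕ} (A : Matrix (Fin (n+1)) (Fin (n+1)) T)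
    (hA : T.regular A) :
    T.regular (T.adj A) ∧
    T.regular (T.pinv A) ∧
    T.mul (T.det A) (T.det (T.pinv A)) = T.real 0 ∧
    T.det (T.pinv A) = T.dinv (T.det A) ∧
    (A = T.pinv A → T.det A = T.real 0) := by
  obtain ⟨w, hw⟩ : ∃ w, T.det A = T.real w := by
    revert hA
    unfold T.regular
    cases T.det A <;> simp [T.isReal]
  have hpinv := T.det_pinv hw
  refine ⟨?_, ?_, ?_, ?_, fun h => ?_⟩
  · simp [T.regular, T.det_adj hw, T.isReal]
  · simp [T.regular, hpinv, T.isReal]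
  · simp [hw, hpinv, T.mul]
  · rw [hw, hpinv, T.dinv]
  · have h' : T.real w = T.real (-w) := by rw [← hw, ← hpinv, ← h]
    rw [hw]
    congr 1
    linarith [T.real.inj h']
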